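/- arXiv:2411.09382 — 4 statements merged into one kernel-verified Lean document; each statement's English description precedes it below -/
import Mathlib

section
/- Let m ≥ 2 be an integer, let α_1,…,α_{m−1} be positive integers, let M_1,…,M_{m−1} be positive real numbers and let V > 0. Define f : ℝ → ℝ by f(x) = ∏_{j=1}^{m−1}(M_j/V − x)^{α_j} − x. Then f has exactly one zero in the open interval (0, min_{1≤j≤m−1} M_j/V); i.e. there exists a unique x* with 0 < x* < min_{1≤j≤m−1} M_j/V and f(x*) = 0. -/
/-- Existence and uniqueness of the equilibrium value: the function
`f(x) = ∏_{j=1}^{m-1} (M j / V - x)^{α j} - x` has exactly one zero in the open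
interval `(0, min_j M j / V)`. -/
theorem stmt_0 (m : ℕ) (hm : 2 ≤ m) (α : ℕ → ℕ)
    (hα : ∀ j ∈ Finset.Icc 1 (m - 1), 0 < α j)
    (M : ℕ → ℝ) (hM : ∀ j ∈ Finset.Icc 1 (m - 1), 0 < M j)
    (V : ℝ) (hV : 0 < V) :
    ∃! x : ℝ,
      x ∈ Set.Ioo (0 : ℝ)
          ((Finset.Icc 1 (m - 1)).inf' (Finset.nonempty_Icc.mpr (by omega))
            (fun j => M j / V)) ∧
        (∏ j ∈ Finset.Icc 1 (m - 1), (M j / V - x) ^ α j) - x = 0 := by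
  have hne : (Finset.Icc 1 (m - 1)).Nonempty := Finset.nonempty_Icc.mpr (by omega)
  obtain ⟨k, hk, hkeq⟩ := Finset.exists_mem_eq_inf' hne (fun j => M j / V)
  have hle : ∀ j ∈ Finset.Icc 1 (m - 1), M k / V ≤ M j / V := by
    intro j hj
    have h := Finset.inf'_le (fun j => M j / V) hj
    rw [hkeq] at h
    exact h
  rw [hkeq]
  have hpos : 0 < M k / V := div_pos (hM k hk) hV
  have hanti : ∀ x y : ℝ, x < y → y < M k / V →
      (∏ j ∈ Finset.Icc 1 (m - 1), (M j / V - y) ^ α j)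
        ≤ ∏ j ∈ Finset.Icc 1 (m - 1), (M j / V - x) ^ α j := by
    intro x y hxy hy
    refine Finset.prod_le_prod ?_ ?_
    · intro j hj
      have := hle j hj
      exact pow_nonneg (by linarith) _
    · intro j hj
      have := hle j hj
      exact pow_le_pow_left₀ (by linarith) (by linarith) _
  have hcont : ContinuousOn
      (fun x : ℝ => (∏ j ∈ Finset.Icc 1 (m - 1), (M j / V - x) ^ α j) - x)
      (Set.Icc 0 (M k / V)) := by
    apply Continuous.continuousOn
    fun_prop
  have h0 : 0 < (∏ j ∈ Finset.Icc 1 (m - 1), (M j / V - (0 : ℝ)) ^ α j) - 0 := by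
    rw [sub_zero]
    refine Finset.prod_pos fun j hj => pow_pos ?_ _
    rw [sub_zero]
    exact div_pos (hM j hj) hV
  have h1 : (∏ j ∈ Finset.Icc 1 (m - 1), (M j / V - M k / V) ^ α j) - M k / V < 0 := by
    rw [Finset.prod_eq_zero hk (by rw [sub_self, zero_pow (hα k hk).ne'])]
    linarith
  obtain ⟨x, hx, hfx⟩ := intermediate_value_Ioo' hpos.le hcont ⟨h1, h0⟩
  refine ⟨x, ⟨hx, hfx⟩, ?_⟩
  rintro y ⟨hy, hfy⟩
  simp only at hfx
  rcases lt_trichotomy y x with h | h | h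
  · have := hanti y x h hx.2
    linarith
  · exact h
  · have := hanti x y h hy.2
    linarith
end

section
/- There exists a constant C_Γ > 0 such that for all real numbers x > 0 and y > 0 with x ≠ y, (x ln(x/y) − x + y)/(√x − √y)² ≤ C_Γ · max{1, ln(x/y)}. -/
/-- There is a constant `C_Γ > 0` such that for all positive `x ≠ y`,
`(x ln(x/y) - x + y)/(√x - √y)² ≤ C_Γ · max{1, ln(x/y)}`. -/
theorem stmt_3 :
    ∃ C : ℝ, 0 < C ∧ ∀ x y : ℝ, 0 < x → 0 < y → x ≠ y →
      (x * Real.log (x / y) - x + y) / (Real.sqrt x - Real.sqrt y) ^ 2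
        ≤ C * max 1 (Real.log (x / y)) := by
  refine ⟨5, by norm_num, ?_⟩
  intro x y hx hy hxy
  obtain ⟨a, ha, rfl⟩ : ∃ a : ℝ, 0 < a ∧ a ^ 2 = x :=
    ⟨Real.sqrt x, Real.sqrt_pos.2 hx, Real.sq_sqrt hx.le⟩
  obtain ⟨b, hb, rfl⟩ : ∃ b : ℝ, 0 < b ∧ b ^ 2 = y :=
    ⟨Real.sqrt y, Real.sqrt_pos.2 hy, Real.sq_sqrt hy.le⟩
  rw [Real.sqrt_sq ha.le, Real.sqrt_sq hb.le]
  have hab : a - b ≠ 0 := by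
    intro h
    apply hxy
    rw [sub_eq_zero.1 h]
  have hpos : 0 < (a - b) ^ 2 := by positivity
  have hL : Real.log (a ^ 2 / b ^ 2) = 2 * Real.log (a / b) := by
    rw [← div_pow, Real.log_pow]; norm_num
  rw [div_le_iff₀ hpos]
  have h1 : (1 : ℝ) ≤ max 1 (Real.log (a ^ 2 / b ^ 2)) := le_max_left _ _
  have h2 : Real.log (a ^ 2 / b ^ 2) ≤ max 1 (Real.log (a ^ 2 / b ^ 2)) := le_max_right _ _
  generalize max 1 (Real.log (a ^ 2 / b ^ 2)) = M at *
  rw [hL] at h2 ⊢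
  obtain ⟨t, ht, rfl⟩ : ∃ t : ℝ, 0 < t ∧ t * b = a :=
    ⟨a / b, by positivity, by field_simp⟩
  have htb : t * b / b = t := by field_simp
  rw [htb] at h2 ⊢
  have hlog := Real.log_le_sub_one_of_pos ht
  have hb2 : 0 < b ^ 2 := by positivity
  have key : t ^ 2 * (2 * Real.log t) - t ^ 2 + 1 ≤ 5 * M * (t - 1) ^ 2 := by
    rcases le_total t 2 with h | h
    · have e1 : t ^ 2 * (2 * Real.log t) ≤ t ^ 2 * (2 * (t - 1)) := by gcongr
      have e2 : 0 ≤ (2 - t) * (t - 1) ^ 2 := mul_nonneg (by linarith) (sq_nonneg _)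
      have e3 : 0 ≤ (M - 1) * (t - 1) ^ 2 := mul_nonneg (by linarith) (sq_nonneg _)
      nlinarith
    · have e1 : t ^ 2 * (2 * Real.log t) ≤ t ^ 2 * M := by gcongr
      have e2 : t ^ 2 ≤ 4 * (t - 1) ^ 2 := by nlinarith
      have e3 : t ^ 2 * M ≤ 4 * (t - 1) ^ 2 * M := by gcongr
      have e4 : 0 ≤ (t - 1) ^ 2 * M := by positivity
      nlinarith
  calc _ = b ^ 2 * (t ^ 2 * (2 * Real.log t) - t ^ 2 + 1) := by ring
    _ ≤ b ^ 2 * (5 * M * (t - 1) ^ 2) := by gcongr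
    _ = _ := by ring
end

section
/- Let (Ω, μ) be a finite measure space with 0 < μ(Ω) < ∞, let m ≥ 2 be an integer, let α_1,…,α_{m−1} be positive integers with α_m = 1, and let M_1,…,M_{m−1} > 0. Let (a_{1∞},…,a_{m∞}) denote the equilibrium state: a_{m∞} is the unique root in (0, min_i M_i/μ(Ω)) of x ↦ ∏_{j=1}^{m−1}(M_j/μ(Ω) − x)^{α_j} − x, and a_{i∞} = M_i/μ(Ω) − a_{m∞} for i = 1,…,m−1. Then there exists a constant C_LE > 0, depending only on μ(Ω), m, the α_i and the equilibrium values a_{i∞}, with the following property: for all nonnegative integrable functions a_1,…,a_m : Ω → ℝ such that each a_i ln a_i is μ-integrable and ∫_Ω (a_i + a_m) dμ = M_i for every i = 1,…,m−1, one has ∑_{i=1}^{m} α_i ∫_Ω ( a_i ln(a_i/a_{i∞}) − a_i + a_{i∞} ) dμ ≥ C_LE ∑_{i=1}^{m} ( ∫_Ω |a_i − a_{i∞}| dμ )². -/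
open MeasureTheory

lemma ptw (a b : ℝ) (ha : 0 ≤ a) (hb : 0 < b) :
    0 ≤ a * Real.log (a / b) - a + b ∧
    (a - b) ^ 2 ≤ 2 * (a + b) * (a * Real.log (a / b) - a + b) := by
  have key : (√a - √b) ^ 2 ≤ a * Real.log (a / b) - a + b := by
    have h1 := Real.sq_sqrt ha
    have h2 := Real.sq_sqrt hb.le
    rcases ha.eq_or_lt with h | h
    · subst h; simp [h2]
    · have hs : 0 < √a := Real.sqrt_pos.2 h
      have ht : 0 < √b := Real.sqrt_pos.2 hb
      have hl := Real.log_le_sub_one_of_pos (div_pos ht hs)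
      rw [Real.log_div ht.ne' hs.ne', Real.log_sqrt ha, Real.log_sqrt hb.le] at hl
      rw [Real.log_div h.ne' hb.ne']
      have h3 := mul_le_mul_of_nonneg_left hl ha
      have h4 : a * (√b / √a - 1) = √a * √b - a := by
        nth_rw 1 [← h1]
        nth_rw 4 [← h1]
        field_simp
      rw [h4] at h3
      nlinarith
  refine ⟨(sq_nonneg _).trans key, ?_⟩
  have h1 := Real.sq_sqrt ha
  have h2 := Real.sq_sqrt hb.le
  have e : (a - b) ^ 2 = (√a + √b) ^ 2 * (√a - √b) ^ 2 := by
    nth_rw 1 [← h1, ← h2]; ring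
  rw [e]
  refine mul_le_mul ?_ key (sq_nonneg _) (by positivity)
  nlinarith [sq_nonneg (√a - √b)]

lemma one_fn {Ω : Type*} [MeasurableSpace Ω] (μ : Measure Ω) [IsFiniteMeasure μ]
    (f : Ω → ℝ) (b : ℝ) (hb : 0 < b) (hf : ∀ x, 0 ≤ f x) (hi : Integrable f μ)
    (hl : Integrable (fun x => f x * Real.log (f x)) μ) :
    0 ≤ ∫ x, (f x * Real.log (f x / b) - f x + b) ∂μ ∧
    (∫ x, |f x - b| ∂μ) ^ 2 ≤ 2 * (∫ x, f x ∂μ + b * (μ Set.univ).toReal) *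
      ∫ x, (f x * Real.log (f x / b) - f x + b) ∂μ := by
  have hP : Integrable (fun x => f x * Real.log (f x / b) - f x + b) μ := by
    have : Integrable (fun x => f x * Real.log (f x / b)) μ := by
      refine (hl.sub (hi.mul_const (Real.log b))).congr (Filter.Eventually.of_forall fun x => ?_)
      rcases (hf x).eq_or_lt with h | h
      · simp [← h]
      · simp only [Pi.sub_apply]
        rw [Real.log_div h.ne' hb.ne']; ring
    exact (this.sub hi).add (integrable_const b)
  have hX : Integrable (fun x => |f x - b|) μ := (hi.sub (integrable_const b)).abs
  have hA : Integrable (fun x => 2 * (f x + b)) μ := (hi.add (integrable_const b)).const_mul 2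
  have hP0 : 0 ≤ ∫ x, (f x * Real.log (f x / b) - f x + b) ∂μ :=
    integral_nonneg fun x => (ptw _ _ (hf x) hb).1
  refine ⟨hP0, ?_⟩
  have hAe : ∫ x, 2 * (f x + b) ∂μ = 2 * (∫ x, f x ∂μ + b * (μ Set.univ).toReal) := by
    rw [integral_const_mul, integral_add hi (integrable_const b)]
    simp [Measure.real, mul_comm]
  rw [← hAe]
  set X := ∫ x, |f x - b| ∂μ with hXd
  set A := ∫ x, 2 * (f x + b) ∂μ with hAd
  set P := ∫ x, (f x * Real.log (f x / b) - f x + b) ∂μ with hPd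
  have hX0 : 0 ≤ X := integral_nonneg fun x => abs_nonneg _
  have hXA : X ≤ A := integral_mono hX hA fun x => by
    have := hf x
    simp only [abs_le]; constructor <;> linarith
  have key : ∀ t : ℝ, 0 < t → 2 * X ≤ t * A + t⁻¹ * P := by
    intro t ht
    rw [hXd, hAd, hPd, ← integral_const_mul, ← integral_const_mul, ← integral_const_mul,
      ← integral_add (hA.const_mul t) (hP.const_mul t⁻¹)]
    refine integral_mono (hX.const_mul 2) ((hA.const_mul t).add (hP.const_mul t⁻¹)) fun x => ?_
    obtain ⟨h0, h1⟩ := ptw _ _ (hf x) hb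
    have hfx := hf x
    simp only [Pi.add_apply]
    set p := f x * Real.log (f x / b) - f x + b
    have hu : 0 ≤ t * (2 * (f x + b)) := by positivity
    have hv : 0 ≤ t⁻¹ * p := by positivity
    have huv : t * (2 * (f x + b)) * (t⁻¹ * p) = 2 * (f x + b) * p := by field_simp
    refine (abs_le_of_sq_le_sq' ?_ (by linarith)).2
    rw [mul_pow, sq_abs]
    nlinarith [sq_nonneg (t * (2 * (f x + b)) - t⁻¹ * p)]
  rcases hX0.eq_or_lt with h | h
  · rw [← h]; have : 0 ≤ A := hX0.trans hXA
    simp; positivity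
  · have hA0 : 0 < A := h.trans_le hXA
    have := key (X / A) (by positivity)
    rw [div_mul_cancel₀ _ hA0.ne', inv_div] at this
    have h2 : X ≤ A / X * P := by linarith
    calc X ^ 2 = X * X := by ring
      _ ≤ X * (A / X * P) := by gcongr
      _ = A * P := by field_simp

/-- Cziszár–Kullback–Pinsker-type lower bound of the relative entropy: with
`(a_{1∞},…,a_{m∞})` the equilibrium state (as in the reversible reaction, `α_m = 1`),
there is `C_LE > 0` such that for all nonnegative integrable `a_1,…,a_m` with
`a_i ln a_i` integrable and masses `∫ (a_i + a_m) = M_i`,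
`∑_i α_i ∫ (a_i ln(a_i/a_{i∞}) - a_i + a_{i∞}) ≥ C_LE ∑_i (∫ |a_i - a_{i∞}|)²`. -/
theorem stmt_14 {Ω : Type*} [MeasurableSpace Ω] (μ : Measure Ω)
    (hpos : 0 < μ Set.univ) (hfin : μ Set.univ < ⊤)
    (m : ℕ) (hm : 2 ≤ m)
    (α : ℕ → ℕ) (hα : ∀ j ∈ Finset.Icc 1 (m - 1), 0 < α j) (hαm : α m = 1)
    (M : ℕ → ℝ) (hM : ∀ j ∈ Finset.Icc 1 (m - 1), 0 < M j)
    (ainf : ℕ → ℝ)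
    (hroot_pos : 0 < ainf m)
    (hroot_lt : ∀ i ∈ Finset.Icc 1 (m - 1), ainf m < M i / (μ Set.univ).toReal)
    (hroot : (∏ j ∈ Finset.Icc 1 (m - 1),
        (M j / (μ Set.univ).toReal - ainf m) ^ α j) - ainf m = 0)
    (hainf : ∀ i ∈ Finset.Icc 1 (m - 1), ainf i = M i / (μ Set.univ).toReal - ainf m) :
    ∃ C : ℝ, 0 < C ∧
      ∀ a : ℕ → Ω → ℝ,
        (∀ i ∈ Finset.Icc 1 m, ∀ x, 0 ≤ a i x) →
        (∀ i ∈ Finset.Icc 1 m, Integrable (a i) μ) →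
        (∀ i ∈ Finset.Icc 1 m, Integrable (fun x => a i x * Real.log (a i x)) μ) →
        (∀ i ∈ Finset.Icc 1 (m - 1), ∫ x, (a i x + a m x) ∂μ = M i) →
        C * ∑ i ∈ Finset.Icc 1 m, (∫ x, |a i x - ainf i| ∂μ) ^ 2
          ≤ ∑ i ∈ Finset.Icc 1 m, (α i : ℝ) *
              ∫ x, (a i x * Real.log (a i x / ainf i) - a i x + ainf i) ∂μ := by
  haveI : IsFiniteMeasure μ := ⟨hfin⟩
  have hV : 0 < (μ Set.univ).toReal := ENNReal.toReal_pos hpos.ne' hfin.ne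
  set V := (μ Set.univ).toReal with hVd
  have hb : ∀ i ∈ Finset.Icc 1 m, 0 < ainf i := by
    intro i hi
    rw [Finset.mem_Icc] at hi
    rcases eq_or_ne i m with h | h
    · rw [h]; exact hroot_pos
    · have h' : i ∈ Finset.Icc 1 (m - 1) := by rw [Finset.mem_Icc]; omega
      rw [hainf i h']; linarith [hroot_lt i h']
  have hα1 : ∀ i ∈ Finset.Icc 1 m, (1 : ℝ) ≤ α i := by
    intro i hi
    rw [Finset.mem_Icc] at hi
    rcases eq_or_ne i m with h | h
    · rw [h, hαm]; simp
    · have h' : i ∈ Finset.Icc 1 (m - 1) := by rw [Finset.mem_Icc]; omega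
      exact_mod_cast hα i h'
  have hmm : m ∈ Finset.Icc 1 m := by rw [Finset.mem_Icc]; omega
  have h1m : 1 ∈ Finset.Icc 1 (m - 1) := by rw [Finset.mem_Icc]; omega
  obtain ⟨K, hK⟩ : ∃ K, K = 2 * (∑ j ∈ Finset.Icc 1 (m - 1), M j +
      (∑ j ∈ Finset.Icc 1 m, ainf j) * V) := ⟨_, rfl⟩
  have hMs : ∀ i ∈ Finset.Icc 1 (m - 1), M i ≤ ∑ j ∈ Finset.Icc 1 (m - 1), M j := fun i hi =>
    Finset.single_le_sum (f := M) (fun j hj => (hM j hj).le) hi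
  have hbs : ∀ i ∈ Finset.Icc 1 m, ainf i ≤ ∑ j ∈ Finset.Icc 1 m, ainf j := fun i hi =>
    Finset.single_le_sum (f := ainf) (fun j hj => (hb j hj).le) hi
  have hK0 : 0 < K := by
    have h1 := hMs 1 h1m
    have h2 := hM 1 h1m
    have h3 := hbs m hmm
    have : 0 < (∑ j ∈ Finset.Icc 1 m, ainf j) * V := mul_pos (by linarith) hV
    rw [hK]; linarith
  refine ⟨K⁻¹, inv_pos.2 hK0, fun a ha hi hl hmass => ?_⟩
  have hmass' : ∀ i ∈ Finset.Icc 1 (m - 1), ∫ x, a i x ∂μ ≤ M i ∧ ∫ x, a m x ∂μ ≤ M i := by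
    intro i h
    have hi' : i ∈ Finset.Icc 1 m := by rw [Finset.mem_Icc] at *; omega
    have h1 := hmass i h
    rw [integral_add (hi i hi') (hi m hmm)] at h1
    have h2 : 0 ≤ ∫ x, a i x ∂μ := integral_nonneg (ha i hi')
    have h3 : 0 ≤ ∫ x, a m x ∂μ := integral_nonneg (ha m hmm)
    constructor <;> linarith
  have hmass2 : ∀ i ∈ Finset.Icc 1 m, ∫ x, a i x ∂μ ≤ ∑ j ∈ Finset.Icc 1 (m - 1), M j := by
    intro i hi
    rw [Finset.mem_Icc] at hi
    rcases eq_or_ne i m with h | h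
    · rw [h]; exact (hmass' 1 h1m).2.trans (hMs 1 h1m)
    · have h' : i ∈ Finset.Icc 1 (m - 1) := by rw [Finset.mem_Icc]; omega
      exact (hmass' i h').1.trans (hMs i h')
  rw [Finset.mul_sum]
  refine Finset.sum_le_sum fun i h => ?_
  obtain ⟨h0, h1⟩ := one_fn μ (a i) (ainf i) (hb i h) (ha i h) (hi i h) (hl i h)
  have h2 : 2 * (∫ x, a i x ∂μ + ainf i * V) ≤ K := by
    have h3 := mul_le_mul_of_nonneg_right (hbs i h) hV.le
    have h4 := hmass2 i h
    rw [hK]; linarith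
  have h5 := h1.trans (mul_le_mul_of_nonneg_right h2 h0)
  rw [inv_mul_le_iff₀ hK0]
  refine h5.trans (mul_le_mul_of_nonneg_left ?_ hK0.le)
  exact le_mul_of_one_le_left h0 (hα1 i h)
end

section
/- There exists a constant C_Γ > 0 with the following property. Let (Ω, μ) be a finite measure space, let m ≥ 1 be an integer, let α_1,…,α_m be positive reals, let a_{1∞},…,a_{m∞} be positive reals, and let a_1,…,a_m : Ω → ℝ be nonnegative measurable functions with a_i ≤ K_i μ-almost everywhere for some constants K_i ≥ 0. Then ∑_{i=1}^{m} α_i ∫_Ω ( a_i ln(a_i/a_{i∞}) − a_i + a_{i∞} ) dμ ≤ (max_{1≤i≤m} α_i) · C_Γ · max_{1≤i≤m} max{ 1, ln(K_i + 1) + |ln a_{i∞}| } · ∑_{i=1}^{m} ∫_Ω ( √a_i − √a_{i∞} )² dμ (with the convention that a ln(a/b) = 0 where a = 0). -/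
open MeasureTheory

lemma entropy_pointwise_nonneg {x y : ℝ} (hx : 0 ≤ x) (hy : 0 < y) :
    0 ≤ x * Real.log (x / y) - x + y := by
  rcases hx.eq_or_lt with h | h
  · subst h; simp; exact hy.le
  · have h1 := Real.one_sub_inv_le_log_of_pos (div_pos h hy)
    have h2 := mul_le_mul_of_nonneg_left h1 hx
    have h3 : x * (1 - (x / y)⁻¹) = x - y := by field_simp
    linarith

lemma entropy_pointwise_le {x y M : ℝ} (hx : 0 ≤ x) (hy : 0 < y) (hM : 1 ≤ M)
    (hL : 0 < x → Real.log (x / y) ≤ M) :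
    x * Real.log (x / y) - x + y ≤ 5 * M * (Real.sqrt x - Real.sqrt y) ^ 2 := by
  obtain ⟨s, hs, rfl⟩ : ∃ s : ℝ, 0 ≤ s ∧ x = s ^ 2 :=
    ⟨Real.sqrt x, Real.sqrt_nonneg x, (Real.sq_sqrt hx).symm⟩
  obtain ⟨t, ht, rfl⟩ : ∃ t : ℝ, 0 < t ∧ y = t ^ 2 :=
    ⟨Real.sqrt y, Real.sqrt_pos.mpr hy, (Real.sq_sqrt hy.le).symm⟩
  rw [Real.sqrt_sq hs, Real.sqrt_sq ht.le]
  have hd := sq_nonneg (s - t)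
  have hMd : (s - t) ^ 2 ≤ M * (s - t) ^ 2 := le_mul_of_one_le_left hd hM
  rcases hs.eq_or_lt with h | h
  · subst h
    simp only [ne_eq, OfNat.ofNat_ne_zero, not_false_eq_true, zero_pow, zero_mul]
    nlinarith
  · rcases le_total s (2 * t) with hst | hst
    · have h1 : Real.log (s ^ 2 / t ^ 2) ≤ 2 * (s / t - 1) := by
        rw [← div_pow, Real.log_pow]
        have := Real.log_le_sub_one_of_pos (div_pos h ht)
        push_cast
        linarith
      have h2 := mul_le_mul_of_nonneg_left h1 hx
      have h3 : s ^ 2 * (2 * (s / t - 1)) - s ^ 2 + t ^ 2 = (2 * (s / t) + 1) * (s - t) ^ 2 := by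
        field_simp
        ring
      have h4 : s / t ≤ 2 := by rwa [div_le_iff₀ ht]
      have h5 : (2 * (s / t) + 1) * (s - t) ^ 2 ≤ 5 * (s - t) ^ 2 :=
        mul_le_mul_of_nonneg_right (by linarith) hd
      linarith
    · have h2 := mul_le_mul_of_nonneg_left (hL (by positivity)) hx
      have h3 : s ^ 2 ≤ 4 * (s - t) ^ 2 := by nlinarith
      have h4 : M * s ^ 2 ≤ M * (4 * (s - t) ^ 2) :=
        mul_le_mul_of_nonneg_left h3 (by linarith)
      nlinarith

lemma entropy_log_le {x y K : ℝ} (hy : 0 < y) (hK : x ≤ K) (hx : 0 < x) :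
    Real.log (x / y) ≤ Real.log (K + 1) + |Real.log y| := by
  rw [Real.log_div hx.ne' hy.ne']
  have := Real.log_le_log hx (show x ≤ K + 1 by linarith)
  have := neg_abs_le (Real.log y)
  linarith

lemma entropy_integral_le {Ω : Type} [MeasurableSpace Ω] (μ : Measure Ω) [IsFiniteMeasure μ]
    {f : Ω → ℝ} {y K M : ℝ} (hf : Measurable f) (h0 : ∀ x, 0 ≤ f x) (hy : 0 < y)
    (hK : ∀ᵐ x ∂μ, f x ≤ K) (hM : max 1 (Real.log (K + 1) + |Real.log y|) ≤ M) :
    ∫ x, (f x * Real.log (f x / y) - f x + y) ∂μ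
      ≤ 5 * M * ∫ x, (Real.sqrt (f x) - Real.sqrt y) ^ 2 ∂μ := by
  rw [← integral_const_mul]
  apply integral_mono_of_nonneg
  · exact Filter.Eventually.of_forall fun x => entropy_pointwise_nonneg (h0 x) hy
  · apply Integrable.const_mul
    refine Integrable.of_bound ?_ ((Real.sqrt K + Real.sqrt y) ^ 2) ?_
    · exact (by fun_prop : Measurable fun x => (Real.sqrt (f x) - Real.sqrt y) ^ 2).aestronglyMeasurable
    · filter_upwards [hK] with x hx
      rw [Real.norm_eq_abs, abs_of_nonneg (sq_nonneg _)]
      have h1 := Real.sqrt_le_sqrt hx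
      have h2 := Real.sqrt_nonneg (f x)
      have h3 := Real.sqrt_nonneg y
      apply sq_le_sq'
      · linarith
      · linarith
  · filter_upwards [hK] with x hx
    exact entropy_pointwise_le (h0 x) hy ((le_max_left _ _).trans hM)
      fun hp => (entropy_log_le hy hx hp).trans ((le_max_right _ _).trans hM)

/-- Logarithmic upper bound for the relative entropy: there is a universal `C_Γ > 0`
such that for any finite measure space, positive weights `α_i`, positive equilibrium
values `a_{i∞}` and nonnegative measurable states `a_i` with `a_i ≤ K_i` a.e.,
`∑_i α_i ∫ (a_i ln(a_i/a_{i∞}) - a_i + a_{i∞})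
  ≤ (max_i α_i) · C_Γ · max_i max{1, ln(K_i+1) + |ln a_{i∞}|} · ∑_i ∫ (√a_i - √a_{i∞})²`. -/
theorem stmt_15 : ∃ C : ℝ, 0 < C ∧
    ∀ (Ω : Type) [MeasurableSpace Ω] (μ : Measure Ω), IsFiniteMeasure μ →
    ∀ (m : ℕ) (hm : 1 ≤ m)
      (α : ℕ → ℝ), (∀ i ∈ Finset.Icc 1 m, 0 < α i) →
    ∀ (ainf : ℕ → ℝ), (∀ i ∈ Finset.Icc 1 m, 0 < ainf i) →
    ∀ (a : ℕ → Ω → ℝ), (∀ i ∈ Finset.Icc 1 m, Measurable (a i)) →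
      (∀ i ∈ Finset.Icc 1 m, ∀ x, 0 ≤ a i x) →
    ∀ (K : ℕ → ℝ), (∀ i ∈ Finset.Icc 1 m, 0 ≤ K i) →
      (∀ i ∈ Finset.Icc 1 m, ∀ᵐ x ∂μ, a i x ≤ K i) →
      ∑ i ∈ Finset.Icc 1 m, α i *
          ∫ x, (a i x * Real.log (a i x / ainf i) - a i x + ainf i) ∂μ
        ≤ ((Finset.Icc 1 m).sup' (Finset.nonempty_Icc.mpr hm) α) * C *
            ((Finset.Icc 1 m).sup' (Finset.nonempty_Icc.mpr hm)
              (fun i => max 1 (Real.log (K i + 1) + |Real.log (ainf i)|))) *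
            ∑ i ∈ Finset.Icc 1 m, ∫ x, (Real.sqrt (a i x) - Real.sqrt (ainf i)) ^ 2 ∂μ := by
  refine ⟨5, by norm_num, ?_⟩
  intro Ω _ μ hμ m hm α hα ainf hinf a ha h0 K _ hK
  rw [Finset.mul_sum]
  apply Finset.sum_le_sum
  intro i hi
  have hA := Finset.le_sup' α hi
  have hM := Finset.le_sup' (fun i => max 1 (Real.log (K i + 1) + |Real.log (ainf i)|)) hi
  have h1 := entropy_integral_le μ (ha i hi) (h0 i hi) (hinf i hi) (hK i hi) hM
  have h2 : 0 ≤ ∫ x, (a i x * Real.log (a i x / ainf i) - a i x + ainf i) ∂μ :=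
    integral_nonneg fun x => entropy_pointwise_nonneg (h0 i hi x) (hinf i hi)
  have h3 := mul_le_mul hA h1 h2 ((hα i hi).le.trans hA)
  refine h3.trans (le_of_eq ?_)
  ring
end
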